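/- Let n > 0 be real and τ ≥ 1. Then for every θ ∈ ℝ, the variance of x ↦ (x² − τ/n)_+ under N(θ, 1/n) satisfies Var_{N(θ,1/n)}((x² − τ/n)_+) ≤ 6θ²/n + (4τ^{1/2} + 18)/(n² e^{τ/2}). -/

import Mathlib

open MeasureTheory ProbabilityTheory Real
open scoped NNReal ENNReal

lemma integrable_pow_gaussianReal (μ : ℝ) (v : ℝ≥0) (k : ℕ) :
    Integrable (fun x : ℝ ↦ x ^ k) (gaussianReal μ v) := by
  rcases Nat.eq_zero_or_pos k with rfl | hk
  · simp
  · have h := (memLp_id_gaussianReal (μ := μ) (v := v) (k : ℝ≥0)).integrable_norm_pow hk.ne'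
    refine h.mono' (by fun_prop) (Filter.Eventually.of_forall fun x ↦ ?_)
    simp

lemma iteratedDeriv_exp_sq_half_zero :
    iteratedDeriv 3 (fun t : ℝ ↦ exp (t ^ 2 / 2)) 0 = 0 ∧
      iteratedDeriv 4 (fun t : ℝ ↦ exp (t ^ 2 / 2)) 0 = 3 := by
  have hE : ∀ t : ℝ, HasDerivAt (fun t : ℝ ↦ exp (t ^ 2 / 2)) (exp (t ^ 2 / 2) * t) t := by
    intro t
    have := (((hasDerivAt_id t).pow 2).div_const 2).exp
    simpa using this
  have h1 : deriv (fun t : ℝ ↦ exp (t ^ 2 / 2)) = fun t ↦ t * exp (t ^ 2 / 2) :=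
    funext fun t ↦ by rw [(hE t).deriv]; ring
  have h2 : deriv (fun t : ℝ ↦ t * exp (t ^ 2 / 2)) =
      fun t ↦ (t ^ 2 + 1) * exp (t ^ 2 / 2) :=
    funext fun t ↦ by
      have := ((hasDerivAt_id t).mul (hE t)).deriv
      simp only [id, Pi.mul_def] at this
      rw [this]; ring
  have h3 : deriv (fun t : ℝ ↦ (t ^ 2 + 1) * exp (t ^ 2 / 2)) =
      fun t ↦ (t ^ 3 + 3 * t) * exp (t ^ 2 / 2) :=
    funext fun t ↦ by
      have := (((hasDerivAt_pow 2 t).add_const 1).mul (hE t)).deriv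
      simp only [Pi.mul_def] at this
      rw [this]; push_cast; ring
  have h4 : deriv (fun t : ℝ ↦ (t ^ 3 + 3 * t) * exp (t ^ 2 / 2)) =
      fun t ↦ (t ^ 4 + 6 * t ^ 2 + 3) * exp (t ^ 2 / 2) :=
    funext fun t ↦ by
      have := (((hasDerivAt_pow 3 t).add ((hasDerivAt_id t).const_mul 3)).mul (hE t)).deriv
      simp only [id, Pi.mul_def, Pi.add_def] at this
      rw [this]; push_cast; ring
  constructor
  · simp [iteratedDeriv_succ, iteratedDeriv_zero, h1, h2, h3]
  · simp [iteratedDeriv_succ, iteratedDeriv_zero, h1, h2, h3, h4]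

lemma integral_pow_three_four_gaussianReal :
    ∫ x, x ^ 3 ∂(gaussianReal 0 1) = 0 ∧ ∫ x, x ^ 4 ∂(gaussianReal 0 1) = 3 := by
  have hm : mgf id (gaussianReal 0 1) = fun t : ℝ ↦ exp (t ^ 2 / 2) := by
    rw [mgf_id_gaussianReal]; simp
  have h0 : (0 : ℝ) ∈ interior (integrableExpSet id (gaussianReal 0 1)) := by simp
  have h3 := iteratedDeriv_mgf_zero h0 3
  have h4 := iteratedDeriv_mgf_zero h0 4
  rw [hm] at h3 h4
  rw [iteratedDeriv_exp_sq_half_zero.1] at h3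
  rw [iteratedDeriv_exp_sq_half_zero.2] at h4
  exact ⟨by simpa using h3.symm, by simpa using h4.symm⟩

lemma integral_sq_gaussianReal : ∫ x, x ^ 2 ∂(gaussianReal 0 1) = 1 := by
  have h := variance_id_gaussianReal (μ := 0) (v := 1)
  rw [variance_of_integral_eq_zero (by fun_prop) (by simp)] at h
  simpa using h

lemma integral_sq_sub_sq_sq_gaussianReal (μ : ℝ) :
    ∫ x, (x ^ 2 - μ ^ 2) ^ 2 ∂(gaussianReal μ 1) = 3 + 4 * μ ^ 2 := by
  have hmap : gaussianReal μ 1 = (gaussianReal 0 1).map (fun x ↦ μ + x) := by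
    rw [gaussianReal_map_const_add]; simp
  rw [hmap, integral_map (by fun_prop) (by fun_prop)]
  have e : ∀ x : ℝ, ((μ + x) ^ 2 - μ ^ 2) ^ 2 =
      x ^ 4 + (4 * μ) * x ^ 3 + (4 * μ ^ 2) * x ^ 2 := fun x ↦ by ring
  simp only [e]
  have i := integrable_pow_gaussianReal 0 1
  have i43 : Integrable (fun x : ℝ ↦ x ^ 4 + 4 * μ * x ^ 3) (gaussianReal 0 1) :=
    (i 4).add ((i 3).const_mul _)
  rw [integral_add i43 ((i 2).const_mul _), integral_add (i 4) ((i 3).const_mul _), integral_const_mul, integral_const_mul,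
    integral_pow_three_four_gaussianReal.1, integral_pow_three_four_gaussianReal.2,
    integral_sq_gaussianReal]
  ring

lemma integrable_cosh_mul_gaussianReal (μ a : ℝ) :
    Integrable (fun x ↦ cosh (a * x)) (gaussianReal μ 1) := by
  simp only [cosh_eq, ← neg_mul]
  exact ((integrable_exp_mul_gaussianReal a).add (integrable_exp_mul_gaussianReal (-a))).div_const 2

lemma integral_cosh_mul_gaussianReal (μ a : ℝ) :
    ∫ x, cosh (a * x) ∂(gaussianReal μ 1) = exp (a ^ 2 / 2) * cosh (a * μ) := by
  have h : ∀ t : ℝ, ∫ x, exp (t * x) ∂(gaussianReal μ 1) = exp (μ * t + t ^ 2 / 2) := by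
    intro t
    have := congrFun (mgf_id_gaussianReal (μ := μ) (v := 1)) t
    simpa [mgf] using this
  simp only [cosh_eq, ← neg_mul]
  rw [integral_div, integral_add (integrable_exp_mul_gaussianReal a)
    (integrable_exp_mul_gaussianReal (-a)), h, h, mul_div_assoc', mul_add, ← exp_add, ← exp_add]
  ring_nf

lemma cosh_le_one_add_mul {x y c : ℝ} (hc₀ : 0 ≤ c) (hc₁ : c ≤ 1) (h : x ^ 2 = c * y ^ 2) :
    cosh x ≤ 1 + c * (cosh y - 1) := by
  have hx := Real.hasSum_cosh x
  have hy := ((Real.hasSum_cosh y).mul_left c).add (hasSum_ite_eq (0 : ℕ) (1 - c))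
  have := hasSum_le (fun k ↦ ?_) hx hy
  · linarith
  · rcases Nat.eq_zero_or_pos k with rfl | hk
    · simp
    · have hck : c ^ k ≤ c := pow_le_of_le_one hc₀ hc₁ hk.ne'
      rw [if_neg hk.ne', add_zero, pow_mul, h, mul_pow, pow_mul, mul_div_assoc]
      exact mul_le_mul_of_nonneg_right hck (by positivity)

lemma four_mul_add_sq_le_two_mul_exp {u : ℝ} (hu : 0 ≤ u) :
    4 * u + 10 / 9 * u ^ 2 ≤ 2 * exp u := by
  rcases le_total u 1 with h | h
  · have h3 : 1 + u + u ^ 2 / 2 + u ^ 3 / 6 ≤ exp u := by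
      have := Real.sum_le_exp_of_nonneg hu 4
      simp [Finset.sum_range_succ, Nat.factorial] at this
      linarith
    nlinarith [mul_nonneg hu (sq_nonneg (u - 1))]
  · have h1 := quadratic_le_exp_of_nonneg (sub_nonneg.2 h)
    have h2 : exp u = exp 1 * exp (u - 1) := by rw [← exp_add]; ring_nf
    have h3 := exp_one_gt_d9
    have h4 : 2.718 * (1 + (u - 1) + (u - 1) ^ 2 / 2) ≤ exp u := by
      rw [h2]
      exact mul_le_mul (by linarith) h1 (by nlinarith) (by positivity)
    nlinarith [sq_nonneg (u - 1 - 1 / 4)]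

lemma max_sq_sub_sq_sq_le_cosh {a : ℝ} (ha₀ : 0 < a) (ha : 18 / 5 ≤ a ^ 2) (x : ℝ) :
    (max (x ^ 2 - a ^ 2) 0) ^ 2 ≤ 8 * exp (-a ^ 2) * cosh (a * x) := by
  wlog hx : 0 ≤ x generalizing x
  · simpa using this (-x) (by linarith)
  rcases le_total (x ^ 2 - a ^ 2) 0 with h | h
  · rw [max_eq_right h]
    have := cosh_pos (a * x)
    simp only [ne_eq, OfNat.ofNat_ne_zero, not_false_eq_true, zero_pow]
    positivity
  · rw [max_eq_left h]
    have hax : a ≤ x := by nlinarith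
    have hu : 0 ≤ a * (x - a) / 2 := by
      have := mul_nonneg ha₀.le (sub_nonneg.2 hax)
      linarith
    have h1 := four_mul_add_sq_le_two_mul_exp hu
    have h2 : x ^ 2 - a ^ 2 ≤ 2 * exp (a * (x - a) / 2) := by
      nlinarith [mul_nonneg (sub_nonneg.2 ha) (sq_nonneg (x - a))]
    have h3 : exp (a * (x - a) / 2) ^ 2 = exp (-a ^ 2) * exp (a * x) := by
      rw [← exp_add, ← exp_nat_mul]; congr 1; push_cast; ring
    have h4 : exp (a * x) ≤ 2 * cosh (a * x) := by
      rw [cosh_eq]; have := exp_pos (-(a * x)); linarith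
    calc (x ^ 2 - a ^ 2) ^ 2 ≤ (2 * exp (a * (x - a) / 2)) ^ 2 := by gcongr
      _ = 4 * exp (-a ^ 2) * exp (a * x) := by rw [mul_pow, h3]; ring
      _ ≤ 4 * exp (-a ^ 2) * (2 * cosh (a * x)) := by gcongr
      _ = _ := by ring

lemma exp_three_quarters_le : exp (3 / 4) ≤ 9 / 4 := by
  have h : exp (3 / 4) ^ 4 = exp 1 ^ 3 := by
    rw [← exp_nat_mul, ← exp_nat_mul]; norm_num
  have h3 := exp_one_lt_d9
  refine le_of_pow_le_pow_left₀ (n := 4) (by norm_num) (by norm_num) ?_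
  rw [h]
  calc exp 1 ^ 3 ≤ 2.7182818286 ^ 3 := by gcongr
    _ ≤ _ := by norm_num

lemma exp_nine_fifths_le : exp (9 / 5) ≤ 22 / 3 := by
  have h : exp (9 / 5) ^ 5 = exp 1 ^ 9 := by
    rw [← exp_nat_mul, ← exp_nat_mul]; norm_num
  have h3 := exp_one_lt_d9
  refine le_of_pow_le_pow_left₀ (n := 5) (by norm_num) (by norm_num) ?_
  rw [h]
  calc exp 1 ^ 9 ≤ 2.7182818286 ^ 9 := by gcongr
    _ ≤ _ := by norm_num

lemma eight_mul_exp_mul_cosh_le {a μ : ℝ} (ha : 0 < a) (hμ : μ ^ 2 ≤ 3 / 2) :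
    8 * exp (-(a ^ 2 / 2)) * cosh (a * μ) ≤ 6 * μ ^ 2 + 8 * exp (-(a ^ 2 / 2)) := by
  have hs : √(3 / 2 : ℝ) ^ 2 = 3 / 2 := sq_sqrt (by norm_num)
  have h1 : cosh (a * μ) ≤ 1 + 2 / 3 * μ ^ 2 * (cosh (a * √(3 / 2)) - 1) :=
    cosh_le_one_add_mul (by positivity) (by linarith) (by rw [mul_pow, mul_pow, hs]; ring)
  have h2 : cosh (a * √(3 / 2)) - 1 ≤ exp (a * √(3 / 2)) / 2 := by
    rw [cosh_eq]
    have : exp (-(a * √(3 / 2))) ≤ 1 := exp_le_one_iff.2 (by simp; positivity)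
    linarith
  have h3 : exp (a * √(3 / 2)) ≤ exp (a ^ 2 / 2) * (9 / 4) := by
    calc exp (a * √(3 / 2)) ≤ exp (a ^ 2 / 2 + 3 / 4) := by
          apply exp_le_exp.2; nlinarith [sq_nonneg (a - √(3 / 2))]
      _ ≤ _ := by rw [exp_add]; gcongr; exact exp_three_quarters_le
  have h4 : cosh (a * μ) ≤ 1 + 2 / 3 * μ ^ 2 * (exp (a ^ 2 / 2) * (9 / 8)) := by
    refine h1.trans ?_
    gcongr
    linarith
  have h5 : exp (-(a ^ 2 / 2)) * exp (a ^ 2 / 2) = 1 := by rw [← exp_add]; simp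
  calc 8 * exp (-(a ^ 2 / 2)) * cosh (a * μ)
      ≤ 8 * exp (-(a ^ 2 / 2)) * (1 + 2 / 3 * μ ^ 2 * (exp (a ^ 2 / 2) * (9 / 8))) := by gcongr
    _ = 6 * μ ^ 2 * (exp (-(a ^ 2 / 2)) * exp (a ^ 2 / 2)) + 8 * exp (-(a ^ 2 / 2)) := by ring
    _ = _ := by rw [h5, mul_one]

lemma integral_sq_sub_sq_integral_le {Ω : Type*} {mΩ : MeasurableSpace Ω} {P : Measure Ω}
    [IsProbabilityMeasure P] {f : Ω → ℝ} (hf : MemLp f 2 P) (c : ℝ) :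
    ∫ x, f x ^ 2 ∂P - (∫ x, f x ∂P) ^ 2 ≤ ∫ x, (f x - c) ^ 2 ∂P := by
  have e : ∀ x, (f x - c) ^ 2 = f x ^ 2 - 2 * c * f x + c ^ 2 := fun x ↦ by ring
  have i1 := hf.integrable one_le_two
  have i2 := hf.integrable_sq
  simp only [e]
  have i12 : Integrable (fun x ↦ f x ^ 2 - 2 * c * f x) P := i2.sub (i1.const_mul _)
  rw [integral_add i12 (integrable_const _),
    integral_sub i2 (i1.const_mul _), integral_const_mul]
  simp only [integral_const, probReal_univ, smul_eq_mul, one_mul]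
  nlinarith [sq_nonneg (∫ x, f x ∂P - c)]

lemma integrable_sq_sub_sq_gaussianReal (μ b : ℝ) (v : ℝ≥0) :
    Integrable (fun x ↦ (x ^ 2 - b) ^ 2) (gaussianReal μ v) := by
  have e : (fun x : ℝ ↦ (x ^ 2 - b) ^ 2) = fun x ↦ x ^ 4 - 2 * b * x ^ 2 + b ^ 2 := by
    ext x; ring
  have i := integrable_pow_gaussianReal μ v
  rw [e]
  exact ((i 4).sub ((i 2).const_mul _)).add (integrable_const _)

lemma memLp_max_sq_sub_gaussianReal (μ τ : ℝ) (v : ℝ≥0) :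
    MemLp (fun x ↦ max (x ^ 2 - τ) 0) 2 (gaussianReal μ v) := by
  rw [memLp_two_iff_integrable_sq (by fun_prop)]
  refine (integrable_sq_sub_sq_gaussianReal μ τ v).mono' (by fun_prop)
    (Filter.Eventually.of_forall fun x ↦ ?_)
  rw [norm_of_nonneg (by positivity)]
  refine sq_le_sq.2 ?_
  have := abs_max_sub_max_le_abs (x ^ 2 - τ) 0 0
  simpa using this

lemma variance_thresholding_le_unit (τ μ : ℝ) (hτ : 1 ≤ τ) :
    (∫ x, (max (x ^ 2 - τ) 0) ^ 2 ∂(gaussianReal μ 1))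
        - (∫ x, max (x ^ 2 - τ) 0 ∂(gaussianReal μ 1)) ^ 2 ≤
      6 * μ ^ 2 + (4 * √τ + 18) * exp (-(τ / 2)) := by
  have hL := memLp_max_sq_sub_gaussianReal μ τ 1
  have hs : 1 ≤ √τ := one_le_sqrt.2 hτ
  have hR : 22 * exp (-(τ / 2)) ≤ (4 * √τ + 18) * exp (-(τ / 2)) := by
    gcongr; linarith
  have hvar : (∫ x, (max (x ^ 2 - τ) 0) ^ 2 ∂(gaussianReal μ 1))
        - (∫ x, max (x ^ 2 - τ) 0 ∂(gaussianReal μ 1)) ^ 2 ≤ 3 + 4 * μ ^ 2 := by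
    refine (integral_sq_sub_sq_integral_le hL (max (μ ^ 2 - τ) 0)).trans ?_
    rw [← integral_sq_sub_sq_sq_gaussianReal μ]
    refine integral_mono_of_nonneg (Filter.Eventually.of_forall fun x ↦ by positivity)
      (integrable_sq_sub_sq_gaussianReal _ _ _) (Filter.Eventually.of_forall fun x ↦ ?_)
    refine sq_le_sq.2 ?_
    have := abs_max_sub_max_le_abs (x ^ 2 - τ) (μ ^ 2 - τ) 0
    simpa using this
  have hE := exp_pos (-(τ / 2))
  rcases le_total (3 / 2) (μ ^ 2) with hμ | hμ
  · nlinarith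
  rcases le_total τ (18 / 5) with h | h
  · have h1 : exp (-(9 / 5)) ≤ exp (-(τ / 2)) := exp_le_exp.2 (by linarith)
    have h2 : 3 / 22 ≤ exp (-(9 / 5)) := by
      rw [exp_neg, le_inv_comm₀ (by norm_num) (exp_pos _)]
      exact exp_nine_fifths_le.trans (by norm_num)
    nlinarith
  · have hτs : √τ ^ 2 = τ := sq_sqrt (by linarith)
    have h0 : 0 < √τ := by linarith
    have h1 : ∫ x, (max (x ^ 2 - τ) 0) ^ 2 ∂(gaussianReal μ 1) ≤
        ∫ x, 8 * exp (-τ) * cosh (√τ * x) ∂(gaussianReal μ 1) := by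
      refine integral_mono hL.integrable_sq
        ((integrable_cosh_mul_gaussianReal μ _).const_mul _) fun x ↦ ?_
      have := max_sq_sub_sq_sq_le_cosh h0 (by rw [hτs]; exact h) x
      simpa only [hτs] using this
    have h2 := eight_mul_exp_mul_cosh_le h0 hμ
    rw [integral_const_mul, integral_cosh_mul_gaussianReal, hτs] at h1
    rw [hτs] at h2
    have h3 : 8 * exp (-τ) * (exp (τ / 2) * cosh (√τ * μ)) =
        8 * exp (-(τ / 2)) * cosh (√τ * μ) := by
      rw [show -(τ / 2) = -τ + τ / 2 by ring, exp_add]; ring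
    have h4 := sq_nonneg (∫ x, max (x ^ 2 - τ) 0 ∂(gaussianReal μ 1))
    linarith

/-- variance bound for the soft-thresholded square `x ↦ (x² - τ/n)₊`
under `N(θ, 1/n)`: `Var ≤ 6θ²/n + (4√τ + 18)/(n² e^{τ/2})`. -/
theorem variance_thresholding_le (n τ : ℝ) (hn : 0 < n) (hτ : 1 ≤ τ) (θ : ℝ) :
    (∫ x, (max (x ^ 2 - τ / n) 0) ^ 2 ∂(gaussianReal θ (Real.toNNReal (1 / n))))
        - (∫ x, max (x ^ 2 - τ / n) 0 ∂(gaussianReal θ (Real.toNNReal (1 / n)))) ^ 2 ≤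
      6 * θ ^ 2 / n + (4 * Real.sqrt τ + 18) / (n ^ 2 * Real.exp (τ / 2)) := by
  have hn0 : 0 < √n := sqrt_pos.2 hn
  have hsq : √n ^ 2 = n := sq_sqrt hn.le
  have hmap : gaussianReal θ (Real.toNNReal (1 / n)) =
      (gaussianReal (√n * θ) 1).map (fun x ↦ (√n)⁻¹ * x) := by
    rw [gaussianReal_map_const_mul]
    congr 1
    · field_simp
    · ext
      simp [hsq, hn.le]
  have e : ∀ x : ℝ, max (((√n)⁻¹ * x) ^ 2 - τ / n) 0 = n⁻¹ * max (x ^ 2 - τ) 0 := by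
    intro x
    rw [mul_max_of_nonneg _ _ (by positivity), mul_pow, inv_pow, hsq]
    congr 1 <;> ring
  rw [hmap, integral_map (by fun_prop) (by fun_prop), integral_map (by fun_prop) (by fun_prop)]
  simp only [e]
  simp only [mul_pow, integral_const_mul]
  have h := mul_le_mul_of_nonneg_left (variance_thresholding_le_unit τ (√n * θ) hτ)
    (by positivity : 0 ≤ n⁻¹ ^ 2)
  rw [mul_pow √n, hsq, exp_neg] at h
  rw [← mul_sub]
  refine h.trans_eq ?_
  field_simp
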